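/- (Random-walk representation of the discrete heat kernel.) Let d₁≥1 be an integer, ρ>0, l₁,…,l_{d₁}∈ℤ^d, and let λ₁,…,λ_{d₁} : ℤ→ℝ be nonnegative functions with 2ρΣ_{k=1}^{d₁}λ_k(t)≤1 for every t∈ℤ; let G be the associated discrete heat kernel. Let (Y_j)_{j∈ℤ} be independent ℤ^d-valued random variables on a probability space such that the law of Y_j is the measure ρΣ_{k=1}^{d₁}λ_k(j)(δ_{l_k}+δ_{−l_k}) + (1−2ρΣ_{k=1}^{d₁}λ_k(j))δ_0 on ℤ^d (δ_v denoting the Dirac mass at v). Then for all integers m<n and all x∈ℤ^d, G(m,n,x) = P( Σ_{j=m}^{n−1} Y_j = x ). -/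

import Mathlib

open scoped ENNReal BigOperators
open MeasureTheory

noncomputable section

/-- The point masses of a sum of two independent random variables. -/
theorem measure_add_eq_lintegral {Ω E : Type*} [MeasurableSpace Ω] {P : Measure Ω}
    [IsProbabilityMeasure P] [AddGroup E] [MeasurableSpace E] [MeasurableAdd₂ E]
    [MeasurableSingletonClass E] {S Y : Ω → E}
    (hS : Measurable S) (hY : Measurable Y) (hSY : ProbabilityTheory.IndepFun S Y P) (x : E) :
    P {ω | S ω + Y ω = x} = ∫⁻ y, P {ω | S ω = x - y} ∂(P.map Y) := by
  have hs : MeasurableSet {p : E × E | p.1 + p.2 = x} :=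
    measurable_add (measurableSet_singleton x)
  have := Measure.isProbabilityMeasure_map (μ := P) hS.aemeasurable
  have := Measure.isProbabilityMeasure_map (μ := P) hY.aemeasurable
  have hprod := (ProbabilityTheory.indepFun_iff_map_prod_eq_prod_map_map
    hS.aemeasurable hY.aemeasurable).1 hSY
  have hmap : P {ω | S ω + Y ω = x} =
      (P.map fun ω => (S ω, Y ω)) {p : E × E | p.1 + p.2 = x} := by
    rw [Measure.map_apply (hS.prodMk hY) hs]
    rfl
  rw [hmap, hprod, Measure.prod_apply_symm hs]
  refine lintegral_congr fun y => ?_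
  have hsec : (fun z : E => (z, y)) ⁻¹' {p : E × E | p.1 + p.2 = x} = {x - y} := by
    ext z
    simp [eq_sub_iff_add_eq]
  rw [hsec, Measure.map_apply hS (measurableSet_singleton _)]
  rfl

/-- Lemma 11.1 (i): random-walk representation of the discrete heat kernel. -/
theorem heat_kernel_random_walk_representation
    (d d₁ : ℕ) (hd₁ : 1 ≤ d₁) (ρ : ℝ) (hρ : 0 < ρ)
    (l : Fin d₁ → Fin d → ℤ)
    (lam : Fin d₁ → ℤ → ℝ) (hlam : ∀ k t, 0 ≤ lam k t)
    (hlam' : ∀ t : ℤ, 2 * ρ * ∑ k, lam k t ≤ 1)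
    (G : ℤ → ℤ → (Fin d → ℤ) → ℝ)
    (hG0 : ∀ (m : ℤ) (y : Fin d → ℤ), G m m y = if y = 0 then 1 else 0)
    (hGrec : ∀ m nn : ℤ, m ≤ nn → ∀ y, G m (nn + 1) y =
      G m nn y + ρ * ∑ k, lam k nn * (G m nn (y + l k) - 2 * G m nn y + G m nn (y - l k)))
    (Ω : Type*) [MeasurableSpace Ω] (P : Measure Ω) [IsProbabilityMeasure P]
    (Y : ℤ → Ω → (Fin d → ℤ)) (hYmeas : ∀ j, Measurable (Y j))
    (hYindep : ProbabilityTheory.iIndepFun (m := fun _ : ℤ => inferInstance) Y P)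
    (hYlaw : ∀ j : ℤ, Measure.map (Y j) P =
      (∑ k : Fin d₁, ENNReal.ofReal (ρ * lam k j) • (Measure.dirac (l k) + Measure.dirac (-l k)))
        + ENNReal.ofReal (1 - 2 * ρ * ∑ k, lam k j) • Measure.dirac (0 : Fin d → ℤ)) :
    ∀ m nn : ℤ, m < nn → ∀ x : Fin d → ℤ,
      G m nn x = (P {ω | (∑ j ∈ Finset.Ico m nn, Y j ω) = x}).toReal := by
  have key : ∀ m nn : ℤ, m ≤ nn → ∀ x : Fin d → ℤ,
      G m nn x = (P {ω | (∑ j ∈ Finset.Ico m nn, Y j ω) = x}).toReal := by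
    intro m nn hmn
    induction nn, hmn using Int.leInduction with
    | base =>
      intro x
      rw [hG0]
      by_cases hx : x = 0
      · simp [hx]
      · simp [hx, Ne.symm hx]
    | succ n hmn ih =>
      intro x
      have hnot : n ∉ Finset.Ico m n := by simp
      have hIco : Finset.Ico m (n + 1) = insert n (Finset.Ico m n) := by
        ext j
        simp only [Finset.mem_Ico, Finset.mem_insert]
        omega
      have hS : Measurable fun ω => ∑ j ∈ Finset.Ico m n, Y j ω :=
        Finset.measurable_fun_sum _ fun j _ => hYmeas j
      have hind : ProbabilityTheory.IndepFun (fun ω => ∑ j ∈ Finset.Ico m n, Y j ω) (Y n) P := by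
        have h := hYindep.indepFun_finsetSum_of_notMem hYmeas hnot
        convert h using 1
        ext ω
        simp
      have hset : {ω | (∑ j ∈ Finset.Ico m (n + 1), Y j ω) = x} =
          {ω | (∑ j ∈ Finset.Ico m n, Y j ω) + Y n ω = x} := by
        simp only [hIco, Finset.sum_insert hnot, add_comm]
      have hrho : ∀ k, 0 ≤ ρ * lam k n := fun k => mul_nonneg hρ.le (hlam k n)
      rw [hset, measure_add_eq_lintegral hS (hYmeas n) hind, hYlaw, lintegral_add_measure,
        lintegral_finsetSum_measure, hGrec m n hmn]
      simp only [lintegral_smul_measure, lintegral_add_measure, lintegral_dirac, smul_eq_mul,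
        sub_neg_eq_add, sub_zero]
      rw [ENNReal.toReal_add (ENNReal.sum_ne_top.2 fun k _ => by finiteness) (by finiteness),
        ENNReal.toReal_sum (fun k _ => by finiteness), ENNReal.toReal_mul,
        ENNReal.toReal_ofReal (sub_nonneg.2 (hlam' n)), ← ih]
      have hterm : ∀ k, (ENNReal.ofReal (ρ * lam k n) *
          (P {ω | (∑ j ∈ Finset.Ico m n, Y j ω) = x - l k} +
            P {ω | (∑ j ∈ Finset.Ico m n, Y j ω) = x + l k})).toReal =
          ρ * lam k n * (G m n (x - l k) + G m n (x + l k)) := by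
        intro k
        rw [ENNReal.toReal_mul, ENNReal.toReal_ofReal (hrho k),
          ENNReal.toReal_add (by finiteness) (by finiteness), ← ih, ← ih]
      simp only [hterm]
      rw [sub_mul, one_mul, add_sub_left_comm, Finset.mul_sum, Finset.mul_sum, Finset.sum_mul,
        ← Finset.sum_sub_distrib]
      congr 1
      refine Finset.sum_congr rfl fun k _ => ?_
      ring
  exact fun m nn hmn => key m nn hmn.le
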